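/- arXiv:math/0409407 — 2 statements merged into one kernel-verified Lean document; each statement's English description precedes it below -/
import Mathlib

section
/- Let r = 2, s = 1, α = √2 − 1 and β = α/2. Write f_{2,1}^n(0, 0, 0) = (x(n), y(n), z(n)) and define w_n = 1 if x(n) + y(n) > z(n) (i.e., the (n+1)-st application of f_{2,1} uses the branch (x−r, y, z−x+1)), and w_n = 0 otherwise. Then for all n ∈ ℕ, w_n = ⌊(n+1)α + β⌋ − ⌊nα + β⌋; that is, w is the Sturmian word of slope √2 − 1 and intercept (√2 − 1)/2. -/
/-- The one-dimensional rotor-router equilibration map on recurrent-state triples,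
`f_{r,s}(x,y,z) = (x, y+s, z-y)` if `x+y ≤ z`, and `(x-r, y, z-x+1)` otherwise. -/
def rotorF (r s : ℤ) : ℤ × ℤ × ℤ → ℤ × ℤ × ℤ
  | (x, y, z) => if x + y ≤ z then (x, y + s, z - y) else (x - r, y, z - x + 1)

/-- The binary word recording which branch of `f_{2,1}` is used at each step of the orbit of
`(0,0,0)`: `w n = 1` if the `(n+1)`-st application uses the branch `(x−r, y, z−x+1)`
(i.e. `x(n) + y(n) > z(n)`), and `w n = 0` otherwise. -/
def rotorWord (n : ℕ) : ℤ :=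
  if ((rotorF 2 1)^[n] (0, 0, 0)).2.2 < ((rotorF 2 1)^[n] (0, 0, 0)).1 + ((rotorF 2 1)^[n] (0, 0, 0)).2.1
  then 1 else 0

theorem rotor_key (a b : ℤ) (ha : 0 ≤ a) (hb : 0 ≤ b) :
    ((a : ℝ) + 1 ≤ ((a + b : ℝ) + 1) * (Real.sqrt 2 - 1) + (Real.sqrt 2 - 1) / 2) ↔
      2 * (a + 1) ^ 2 ≤ b * (b + 1) := by
  have h2 : Real.sqrt 2 ^ 2 = 2 := Real.sq_sqrt (by norm_num)
  have h0 : 1 < Real.sqrt 2 := by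
    rw [Real.lt_sqrt] <;> norm_num
  have haR : (0 : ℝ) ≤ a := by exact_mod_cast ha
  have hbR : (0 : ℝ) ≤ b := by exact_mod_cast hb
  have e1 : ((a : ℝ) + 1 ≤ ((a + b : ℝ) + 1) * (Real.sqrt 2 - 1) + (Real.sqrt 2 - 1) / 2) ↔
      2 * Real.sqrt 2 * (a + 1) ≤ 2 * b + 1 := by
    have : 2 * (((a + b : ℝ) + 1) * (Real.sqrt 2 - 1) + (Real.sqrt 2 - 1) / 2 - (a + 1))
        = (Real.sqrt 2 - 1) * (2 * b + 1 - 2 * Real.sqrt 2 * (a + 1)) := by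
      linear_combination (2 * (a : ℝ) + 2) * h2
    constructor
    · intro h
      have h' : 0 ≤ (Real.sqrt 2 - 1) * (2 * b + 1 - 2 * Real.sqrt 2 * (a + 1)) := by linarith
      have := nonneg_of_mul_nonneg_right h' (by linarith)
      linarith
    · intro h
      have := mul_nonneg (by linarith : 0 ≤ Real.sqrt 2 - 1) (sub_nonneg.2 h)
      linarith
  rw [e1, ← sq_le_sq₀ (by positivity) (by positivity)]
  have e2 : (2 * Real.sqrt 2 * ((a : ℝ) + 1)) ^ 2 = ((8 * (a + 1) ^ 2 : ℤ) : ℝ) := by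
    push_cast
    linear_combination 4 * ((a : ℝ) + 1) ^ 2 * h2
  have e3 : (2 * (b : ℝ) + 1) ^ 2 = ((4 * (b * (b + 1)) + 1 : ℤ) : ℝ) := by
    push_cast; ring
  rw [e2, e3, Int.cast_le]
  constructor <;> intro h <;> omega

theorem rotor_inv (n : ℕ) : ∃ a b z : ℤ, (rotorF 2 1)^[n] (0, 0, 0) = (-2 * a, b, z) ∧
    0 ≤ a ∧ 0 ≤ b ∧ a + b = n ∧ 2 * z = 2 * a ^ 2 - b * (b - 1) ∧
    ⌊(n : ℝ) * (Real.sqrt 2 - 1) + (Real.sqrt 2 - 1) / 2⌋ = a ∧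
    ⌊((n : ℝ) + 1) * (Real.sqrt 2 - 1) + (Real.sqrt 2 - 1) / 2⌋ =
      a + if z < -2 * a + b then 1 else 0 := by
  have h0 : 1 < Real.sqrt 2 := by
    rw [Real.lt_sqrt] <;> norm_num
  have h1 : Real.sqrt 2 < 2 := by
    rw [Real.sqrt_lt'] <;> norm_num
  have step : ∀ (n : ℕ) (a b z : ℤ), 0 ≤ a → 0 ≤ b → a + b = n →
      2 * z = 2 * a ^ 2 - b * (b - 1) →
      ⌊(n : ℝ) * (Real.sqrt 2 - 1) + (Real.sqrt 2 - 1) / 2⌋ = a →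
      ⌊((n : ℝ) + 1) * (Real.sqrt 2 - 1) + (Real.sqrt 2 - 1) / 2⌋ =
        a + if z < -2 * a + b then 1 else 0 := by
    intro n a b z ha hb hn hz hf
    have hk := rotor_key a b ha hb
    have hnR : (a : ℝ) + b = n := by exact_mod_cast hn
    rw [hnR] at hk
    rw [Int.floor_eq_iff] at hf ⊢
    obtain ⟨f1, f2⟩ := hf
    have hc : z < -2 * a + b ↔ 2 * (a + 1) ^ 2 ≤ b * (b + 1) := by
      have hev : b * (b + 1) = b * (b - 1) + 2 * b := by ring
      have : 2 * (a + 1) ^ 2 = 2 * a ^ 2 + 4 * a + 2 := by ring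
      constructor <;> intro h <;> omega
    rw [← hc] at hk
    split_ifs with h
    · have := hk.2 h
      push_cast
      constructor <;> linarith
    · have := lt_of_not_ge (mt hk.1 h)
      push_cast
      constructor <;> linarith
  induction n with
  | zero =>
    have hf : ⌊((0 : ℕ) : ℝ) * (Real.sqrt 2 - 1) + (Real.sqrt 2 - 1) / 2⌋ = 0 := by
      rw [Int.floor_eq_iff]
      push_cast
      constructor <;> linarith
    exact ⟨0, 0, 0, by simp, le_rfl, le_rfl, by simp, by simp, hf,
      step 0 0 0 0 le_rfl le_rfl (by simp) (by simp) hf⟩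
  | succ n ih =>
    obtain ⟨a, b, z, hi, ha, hb, hn, hz, hf, hg⟩ := ih
    rw [Function.iterate_succ_apply', hi]
    by_cases h : z < -2 * a + b
    · rw [if_pos h] at hg
      have e : rotorF 2 1 (-2 * a, b, z) = (-2 * (a + 1), b, z + 2 * a + 1) := by
        simp only [rotorF]
        rw [if_neg (by omega)]
        ext <;> simp <;> ring
      have p1 : a + 1 + b = ((n + 1 : ℕ) : ℤ) := by push_cast; omega
      have p2 : 2 * (z + 2 * a + 1) = 2 * (a + 1) ^ 2 - b * (b - 1) := by
        linear_combination hz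
      have p3 : ⌊((n + 1 : ℕ) : ℝ) * (Real.sqrt 2 - 1) + (Real.sqrt 2 - 1) / 2⌋ = a + 1 := by
        rw [← hg]; push_cast; rfl
      exact ⟨a + 1, b, _, e, by omega, hb, p1, p2, p3,
        step _ _ _ _ (by omega) hb p1 p2 p3⟩
    · rw [if_neg h] at hg
      have e : rotorF 2 1 (-2 * a, b, z) = (-2 * a, b + 1, z - b) := by
        simp only [rotorF]
        rw [if_pos (by omega)]
      have p1 : a + (b + 1) = ((n + 1 : ℕ) : ℤ) := by push_cast; omega
      have p2 : 2 * (z - b) = 2 * a ^ 2 - (b + 1) * (b + 1 - 1) := by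
        linear_combination hz
      have p3 : ⌊((n + 1 : ℕ) : ℝ) * (Real.sqrt 2 - 1) + (Real.sqrt 2 - 1) / 2⌋ = a := by
        rw [add_zero] at hg
        rw [← hg]; push_cast; rfl
      exact ⟨a, b + 1, _, e, ha, by omega, p1, p2, p3,
        step _ _ _ _ ha (by omega) p1 p2 p3⟩

/-- For `r = 2`, `s = 1` and initial state `(0,0,0)`, the branch word of the rotor-router
orbit is the Sturmian word of slope `α = √2 − 1` and intercept `β = α/2`:
`w n = ⌊(n+1)α + β⌋ − ⌊nα + β⌋`. -/
theorem rotorWord_sturmian (n : ℕ) :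
    rotorWord n =
      ⌊((n : ℝ) + 1) * (Real.sqrt 2 - 1) + (Real.sqrt 2 - 1) / 2⌋ -
        ⌊(n : ℝ) * (Real.sqrt 2 - 1) + (Real.sqrt 2 - 1) / 2⌋ := by
  obtain ⟨a, b, z, hi, -, -, -, -, hf, hg⟩ := rotor_inv n
  rw [hf, hg, rotorWord, hi]
  simp
end

section
/- Let d = 2 (with any choice of rotor ordering ε). For every ε₀ > 0 there exists M ∈ ℕ such that for all m ≥ M, every site (a, b) ∈ ℤ² with (a² + b²)² < 8m/(3·e^{6+ε₀}) belongs to A_m; that is, after m particles are deposited and allowed to equilibrate, every site in the open disc of radius (8m/(3e^{6+ε₀}))^{1/4} centered at the origin is occupied. -/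
/-- Lattice points of `ℤ^d`. -/
abbrev Zd (d : ℕ) := Fin d → ℤ

/-- The set `E_d = {±e_1, …, ±e_d}` of cardinal directions in `ℤ^d`. -/
def Ed (d : ℕ) : Set (Zd d) :=
  {v | ∃ i : Fin d, v = Pi.single i 1 ∨ v = Pi.single i (-1)}

/-- Increment an element of `Fin n` by one, cyclically. -/
def finInc {n : ℕ} (j : Fin n) : Fin n :=
  ⟨(j.val + 1) % n, Nat.mod_lt _ (Nat.lt_of_le_of_lt (Nat.zero_le _) j.isLt)⟩

/-- One step of the rotor-router automaton: the particle at `p` moves in the direction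
`ε(ℓ(p))` of the rotor at `p`, and that rotor is incremented (cyclically) by one. -/
def rotorStep {d : ℕ} (ε : Fin (2 * d) → Zd d) :
    Zd d × (Zd d → Fin (2 * d)) → Zd d × (Zd d → Fin (2 * d))
  | (p, ℓ) => (p + ε (ℓ p), Function.update ℓ p (finInc (ℓ p)))

/-- The growth map: run the rotor walk from the origin until it first exits the occupied
region, adjoin the exit point, and give it the first rotor direction. -/
noncomputable def grow {d : ℕ} (hd : 0 < d) (ε : Fin (2 * d) → Zd d) :
    Finset (Zd d) × (Zd d → Fin (2 * d)) → Finset (Zd d) × (Zd d → Fin (2 * d)) :=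
  fun c =>
    let N := sInf {n | ((rotorStep ε)^[n] (0, c.2)).1 ∉ c.1}
    let w := (rotorStep ε)^[N] (0, c.2)
    (insert w.1 c.1, Function.update w.2 w.1 ⟨0, by omega⟩)

/-- The configuration (occupied region, rotors) after `n` particles have been deposited at
the origin and allowed to equilibrate, starting from `A₀ = {0}` and all rotors in the first
position. -/
noncomputable def conf {d : ℕ} (hd : 0 < d) (ε : Fin (2 * d) → Zd d) (n : ℕ) :
    Finset (Zd d) × (Zd d → Fin (2 * d)) :=
  (grow hd ε)^[n] ({0}, fun _ => ⟨0, by omega⟩)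

namespace RR

abbrev D := Zd 2
abbrev R4 := Fin (2 * 2)

noncomputable def W (ε : R4 → D) (g : D → ℝ) (δ : ℝ) (x : D) (j : R4) : ℝ :=
  ∑ k : R4, if k < j then g (x + ε k) - g x - δ else 0

theorem W_zero (ε : R4 → D) (g : D → ℝ) (δ : ℝ) (x : D) : W ε g δ x ⟨0, by omega⟩ = 0 := by
  unfold W
  apply Finset.sum_eq_zero
  intro k _
  rw [if_neg]
  simp [Fin.lt_def]

theorem W_inc (ε : R4 → D) (g : D → ℝ) (δ : ℝ) (x : D) (j : R4)
    (h : j.val = 3 → 4 * δ ≤ (∑ k, g (x + ε k)) - 4 * g x) :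
    W ε g δ x (finInc j) + δ ≤ W ε g δ x j + (g (x + ε j) - g x) := by
  unfold W
  have e : ∀ f : R4 → ℝ, ∑ k, f k = f 0 + f 1 + f 2 + f 3 := fun f => Fin.sum_univ_four f
  simp only [e] at h ⊢
  fin_cases j <;> simp [finInc, Fin.lt_def] at h ⊢ <;> linarith

/-- one step of the walk -/
theorem psi_step (ε : R4 → D) (g : D → ℝ) (δ : ℝ) (A : Finset D) (s : D × (D → R4))
    (hp : s.1 ∈ A)
    (h : (s.2 s.1).val = 3 → 4 * δ ≤ (∑ k, g (s.1 + ε k)) - 4 * g s.1) :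
    g s.1 - ∑ x ∈ A, W ε g δ x (s.2 x) + δ ≤
      g (rotorStep ε s).1 - ∑ x ∈ A, W ε g δ x ((rotorStep ε s).2 x) := by
  obtain ⟨p, l⟩ := s
  simp only [rotorStep] at *
  have h1 := W_inc ε g δ p (l p) h
  rw [← Finset.add_sum_erase A _ hp, ← Finset.add_sum_erase A _ hp]
  have : ∑ x ∈ A.erase p, W ε g δ x (Function.update l p (finInc (l p)) x)
      = ∑ x ∈ A.erase p, W ε g δ x (l x) := by
    apply Finset.sum_congr rfl
    intro x hx
    rw [Function.update_of_ne (Finset.ne_of_mem_erase hx)]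
  rw [this, Function.update_self]
  linarith

theorem sum_dir (ε : R4 → D)
    (hε₁ : Function.Injective ε) (hε₂ : ∀ k, ε k ∈ Ed 2)
    (hε₃ : ∀ v ∈ Ed 2, ∃ k, ε k = v) (f : D → ℝ) :
    ∑ k, f (ε k) = f ![1, 0] + f ![-1, 0] + f ![0, 1] + f ![0, -1] := by
  have a1 : (Pi.single 0 1 : D) = ![1, 0] := by ext i; fin_cases i <;> simp
  have a2 : (Pi.single 0 (-1) : D) = ![-1, 0] := by ext i; fin_cases i <;> simp
  have a3 : (Pi.single 1 1 : D) = ![0, 1] := by ext i; fin_cases i <;> simp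
  have a4 : (Pi.single 1 (-1) : D) = ![0, -1] := by ext i; fin_cases i <;> simp
  have mem : ∀ v : D, v ∈ Ed 2 ↔ v = ![1, 0] ∨ v = ![-1, 0] ∨ v = ![0, 1] ∨ v = ![0, -1] := by
    intro v
    rw [Ed, Set.mem_ofPred_eq, Fin.exists_fin_two, a1, a2, a3, a4]
    tauto
  have him : Finset.univ.image ε = {![1, 0], ![-1, 0], ![0, 1], ![0, -1]} := by
    ext v
    simp only [Finset.mem_image, Finset.mem_univ, true_and, Finset.mem_insert,
      Finset.mem_singleton, ← mem]
    exact ⟨fun ⟨k, hk⟩ => hk ▸ hε₂ k, fun h => hε₃ v h⟩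
  rw [← Finset.sum_image (g := ε) (f := f) (fun a _ b _ h => hε₁ h), him,
    Finset.sum_insert (by decide), Finset.sum_insert (by decide),
    Finset.sum_insert (by decide), Finset.sum_singleton]
  ring

noncomputable def sq (x : D) : ℝ := (x 0 : ℝ) ^ 2 + (x 1 : ℝ) ^ 2

/-- the walk leaves a finite set -/
theorem exits (ε : R4 → D)
    (hε₁ : Function.Injective ε) (hε₂ : ∀ k, ε k ∈ Ed 2)
    (hε₃ : ∀ v ∈ Ed 2, ∃ k, ε k = v) (A : Finset D) (s : D × (D → R4)) :
    ∃ n, ((rotorStep ε)^[n] s).1 ∉ A := by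
  by_contra! hc
  have hlap : ∀ p : D, 4 * (1 : ℝ) ≤ (∑ k, sq (p + ε k)) - 4 * sq p := by
    intro p
    rw [sum_dir ε hε₁ hε₂ hε₃ (fun v => sq (p + v))]
    simp [sq]
    linarith
  have hmono : ∀ n : ℕ, sq s.1 - ∑ x ∈ A, W ε sq 1 x (s.2 x) + n ≤
      sq ((rotorStep ε)^[n] s).1 - ∑ x ∈ A, W ε sq 1 x (((rotorStep ε)^[n] s).2 x) := by
    intro n
    induction n with
    | zero => simp
    | succ n ih =>
      rw [Function.iterate_succ_apply']
      have := psi_step ε sq 1 A _ (hc n) (fun _ => hlap _)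
      push_cast
      linarith
  have hbd : ∀ n : ℕ, sq ((rotorStep ε)^[n] s).1
      - ∑ x ∈ A, W ε sq 1 x (((rotorStep ε)^[n] s).2 x) ≤
      ∑ x ∈ A, sq x + ∑ x ∈ A, ∑ j, |W ε sq 1 x j| := by
    intro n
    have h1 : sq ((rotorStep ε)^[n] s).1 ≤ ∑ x ∈ A, sq x :=
      Finset.single_le_sum (f := sq) (fun i _ => by unfold sq; positivity) (hc n)
    have h2 : -∑ x ∈ A, W ε sq 1 x (((rotorStep ε)^[n] s).2 x)
        ≤ ∑ x ∈ A, ∑ j, |W ε sq 1 x j| := by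
      rw [← Finset.sum_neg_distrib]
      apply Finset.sum_le_sum
      intro x _
      refine (neg_le_abs _).trans ?_
      exact Finset.single_le_sum (f := fun j => |W ε sq 1 x j|) (fun i _ => abs_nonneg _)
        (Finset.mem_univ _)
    linarith
  obtain ⟨n, hn⟩ := exists_nat_gt (∑ x ∈ A, sq x + ∑ x ∈ A, ∑ j, |W ε sq 1 x j|
    - (sq s.1 - ∑ x ∈ A, W ε sq 1 x (s.2 x)))
  linarith [hmono n, hbd n]

theorem subharm (x y : ℤ) (h : 2 ≤ x ^ 2 + y ^ 2) :
    4 * (1 / ((x : ℝ) ^ 2 + (y : ℝ) ^ 2)) ≤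
    1 / (((x : ℝ) + 1) ^ 2 + (y : ℝ) ^ 2) + 1 / (((x : ℝ) + -1) ^ 2 + (y : ℝ) ^ 2)
    + 1 / ((x : ℝ) ^ 2 + ((y : ℝ) + 1) ^ 2) + 1 / ((x : ℝ) ^ 2 + ((y : ℝ) + -1) ^ 2) := by
  have pos : ∀ a b : ℤ, (a ≠ 0 ∨ b ≠ 0) → 0 < (a : ℝ) ^ 2 + (b : ℝ) ^ 2 := by
    intro a b hab
    have : 0 < a ^ 2 + b ^ 2 := by rcases hab with h | h <;> positivity
    exact_mod_cast this
  have p1 := pos (x + 1) y (by by_contra! hh; obtain ⟨h1, h2⟩ := hh; have : x = -1 := by omega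
                               subst this h2; norm_num at h)
  have p2 := pos (x + -1) y (by by_contra! hh; obtain ⟨h1, h2⟩ := hh; have : x = 1 := by omega
                                subst this h2; norm_num at h)
  have p3 := pos x (y + 1) (by by_contra! hh; obtain ⟨h2, h1⟩ := hh; have : y = -1 := by omega
                               subst this h2; norm_num at h)
  have p4 := pos x (y + -1) (by by_contra! hh; obtain ⟨h2, h1⟩ := hh; have : y = 1 := by omega
                                subst this h2; norm_num at h)
  have hs : (2 : ℝ) ≤ (x : ℝ) ^ 2 + (y : ℝ) ^ 2 := by exact_mod_cast h
  push_cast at p1 p2 p3 p4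
  generalize (x : ℝ) = X at *
  generalize (y : ℝ) = Y at *
  obtain ⟨T, hT⟩ : ∃ T, T = X ^ 2 + Y ^ 2 + 1 := ⟨_, rfl⟩
  obtain ⟨P, hP⟩ : ∃ P, P = T ^ 2 - 4 * X ^ 2 := ⟨_, rfl⟩
  obtain ⟨Q, hQ⟩ : ∃ Q, Q = T ^ 2 - 4 * Y ^ 2 := ⟨_, rfl⟩
  have hP' : P = ((X + 1) ^ 2 + Y ^ 2) * ((X + -1) ^ 2 + Y ^ 2) := by rw [hP, hT]; ring
  have hQ' : Q = (X ^ 2 + (Y + 1) ^ 2) * (X ^ 2 + (Y + -1) ^ 2) := by rw [hQ, hT]; ring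
  have hPp : 0 < P := by rw [hP']; positivity
  have hQp : 0 < Q := by rw [hQ']; positivity
  have e1 : 1 / ((X + 1) ^ 2 + Y ^ 2) + 1 / ((X + -1) ^ 2 + Y ^ 2) = 2 * T / P := by
    rw [hP', hT]; field_simp; ring
  have e2 : 1 / (X ^ 2 + (Y + 1) ^ 2) + 1 / (X ^ 2 + (Y + -1) ^ 2) = 2 * T / Q := by
    rw [hQ', hT]; field_simp; ring
  have e3 : 4 / (P + Q) ≤ 1 / P + 1 / Q := by
    rw [div_add_div _ _ hPp.ne' hQp.ne', div_le_div_iff₀ (by positivity) (by positivity)]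
    nlinarith [sq_nonneg (P - Q)]
  have hTp : 3 ≤ T := by linarith
  have e4 : 4 * (1 / (X ^ 2 + Y ^ 2)) ≤ 2 * T * (4 / (P + Q)) := by
    have : X ^ 2 + Y ^ 2 = T - 1 := by linarith
    have hPQ : P + Q = 2 * T ^ 2 - 4 * (T - 1) := by rw [hP, hQ]; linarith
    rw [this]
    have : 0 < T - 1 := by linarith
    rw [mul_one_div, mul_div_assoc', div_le_div_iff₀ this (by positivity), hPQ]
    nlinarith
  have e5 : 2 * T * (4 / (P + Q)) ≤ 2 * T * (1 / P + 1 / Q) :=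
    mul_le_mul_of_nonneg_left e3 (by linarith)
  have e6 : 2 * T * (1 / P + 1 / Q) = 2 * T / P + 2 * T / Q := by ring
  linarith

noncomputable def G (z x : D) : ℝ := 1 / sq (x - z)

theorem G_nonneg (z x : D) : 0 ≤ G z x := by unfold G sq; positivity

theorem lapG (ε : R4 → D)
    (hε₁ : Function.Injective ε) (hε₂ : ∀ k, ε k ∈ Ed 2)
    (hε₃ : ∀ v ∈ Ed 2, ∃ k, ε k = v) (z x : D) (hxz : x ≠ z)
    (hn : ∀ k, x + ε k ≠ z) : 4 * 0 ≤ (∑ k, G z (x + ε k)) - 4 * G z x := by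
  rw [sum_dir ε hε₁ hε₂ hε₃ (fun v => G z (x + v))]
  have key : 2 ≤ (x 0 - z 0) ^ 2 + (x 1 - z 1) ^ 2 := by
    by_contra! hlt
    have h0 : -1 ≤ x 0 - z 0 ∧ x 0 - z 0 ≤ 1 := by constructor <;> nlinarith
    have h1 : -1 ≤ x 1 - z 1 ∧ x 1 - z 1 ≤ 1 := by constructor <;> nlinarith
    have hxz' : ¬ (x 0 - z 0 = 0 ∧ x 1 - z 1 = 0) := by
      rintro ⟨u, v⟩; apply hxz; ext i; fin_cases i
      · simpa using by omega
      · simpa using by omega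
    have hd : ∀ (i : Fin 2) (c : ℤ), (c = 1 ∨ c = -1) → x + Pi.single i c ≠ z := by
      intro i c hc h
      obtain ⟨k, hk⟩ := hε₃ (Pi.single i c) ⟨i, by rcases hc with rfl | rfl <;> simp⟩
      exact hn k (hk ▸ h)
    obtain ⟨u, hu⟩ : ∃ u, u = x 0 - z 0 := ⟨_, rfl⟩
    obtain ⟨v, hv⟩ : ∃ v, v = x 1 - z 1 := ⟨_, rfl⟩
    rw [← hu, ← hv] at hxz' hlt
    rw [← hu] at h0
    rw [← hv] at h1
    have c0 : ∀ c : ℤ, (c = 1 ∨ c = -1) → ¬ (u + c = 0 ∧ v = 0) := by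
      rintro c hc ⟨h, h'⟩
      apply hd 0 c hc
      ext i; fin_cases i
      · simp; omega
      · simp; omega
    have c1 : ∀ c : ℤ, (c = 1 ∨ c = -1) → ¬ (v + c = 0 ∧ u = 0) := by
      rintro c hc ⟨h, h'⟩
      apply hd 1 c hc
      ext i; fin_cases i
      · simp; omega
      · simp; omega
    have := c0 1 (by simp); have := c0 (-1) (by simp)
    have := c1 1 (by simp); have := c1 (-1) (by simp)
    obtain ⟨h0a, h0b⟩ := h0
    obtain ⟨h1a, h1b⟩ := h1
    clear hu hv hd
    interval_cases u <;> interval_cases v <;> omega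
  have := subharm _ _ key
  push_cast at this
  have e : ∀ a b c : ℝ, a + b - c = a - c + b := by intros; ring
  simp only [G, sq, Pi.sub_apply, Pi.add_apply, Matrix.cons_val_zero, Matrix.cons_val_one]
  push_cast
  simp only [e, add_zero]
  linarith

/-- invariant along a walk avoiding `z` -/
theorem walk (ε : R4 → D)
    (hε₁ : Function.Injective ε) (hε₂ : ∀ k, ε k ∈ Ed 2)
    (hε₃ : ∀ v ∈ Ed 2, ∃ k, ε k = v) (z : D) (A : Finset D) (hzA : z ∉ A)
    (s : D × (D → R4)) (h0 : ∀ x ∉ A, s.2 x = ⟨0, by omega⟩)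
    (hJ : ∀ k, s.2 (z - ε k) ≤ k) (n : ℕ)
    (hn : ∀ i < n, ((rotorStep ε)^[i] s).1 ∈ A)
    (hz : ((rotorStep ε)^[n] s).1 ≠ z) :
    (∀ x ∉ A, ((rotorStep ε)^[n] s).2 x = ⟨0, by omega⟩) ∧
    (∀ k, ((rotorStep ε)^[n] s).2 (z - ε k) ≤ k) ∧
    G z s.1 - ∑ x ∈ A, W ε (G z) 0 x (s.2 x) ≤
      G z ((rotorStep ε)^[n] s).1 - ∑ x ∈ A, W ε (G z) 0 x (((rotorStep ε)^[n] s).2 x) := by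
  induction n with
  | zero => exact ⟨h0, hJ, le_refl _⟩
  | succ n ih =>
    have hpA := hn n (Nat.lt_succ_self n)
    have hpz : ((rotorStep ε)^[n] s).1 ≠ z := fun h => hzA (h ▸ hpA)
    obtain ⟨i1, i2, i3⟩ := ih (fun i hi => hn i (by omega)) hpz
    rw [Function.iterate_succ_apply'] at hz ⊢
    generalize (rotorStep ε)^[n] s = t at *
    have hlt : ∀ k, t.1 + ε k = z → t.2 t.1 < k := by
      intro k hk
      have e : t.1 = z - ε k := by rw [← hk]; simp
      have h1 := i2 k
      rw [← e] at h1
      refine lt_of_le_of_ne h1 ?_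
      intro h2
      apply hz
      change t.1 + ε (t.2 t.1) = z
      rw [h2, hk]
    have inc : ∀ j k : R4, j < k → finInc j ≤ k := by
      intro j k hjk
      have h1 := j.isLt
      have h2 := k.isLt
      rw [Fin.lt_def] at hjk
      rw [Fin.le_def]
      change (j.val + 1) % (2 * 2) ≤ k.val
      omega
    refine ⟨?_, ?_, ?_⟩
    · intro x hx
      change Function.update t.2 t.1 _ x = _
      have hxt : x ≠ t.1 := by
        rintro rfl
        exact hx hpA
      rw [Function.update_of_ne hxt]
      exact i1 x hx
    · intro k
      change Function.update t.2 t.1 _ (z - ε k) ≤ k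
      by_cases h : z - ε k = t.1
      · rw [h, Function.update_self]
        exact inc _ _ (hlt k (by rw [← h]; simp))
      · rw [Function.update_of_ne h]
        exact i2 k
    · have := psi_step ε (G z) 0 A t hpA (by
        intro h3
        apply lapG ε hε₁ hε₂ hε₃ z _ hpz
        intro k hk
        have h4 := hlt k hk
        have := k.isLt
        rw [Fin.lt_def] at h4
        omega)
      linarith

theorem grow_spec (hd : 0 < 2) (ε : R4 → D)
    (hε₁ : Function.Injective ε) (hε₂ : ∀ k, ε k ∈ Ed 2)
    (hε₃ : ∀ v ∈ Ed 2, ∃ k, ε k = v) (z : D) (c : Finset D × (D → R4))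
    (h0 : ∀ x ∉ c.1, c.2 x = ⟨0, by omega⟩)
    (hJ : ∀ k, c.2 (z - ε k) ≤ k) (hz : z ∉ (grow hd ε c).1) :
    (∀ x ∉ (grow hd ε c).1, (grow hd ε c).2 x = ⟨0, by omega⟩) ∧
    (∀ k, (grow hd ε c).2 (z - ε k) ≤ k) ∧
    (grow hd ε c).1.card ≤ c.1.card + 1 ∧
    (∑ x ∈ c.1, (G z x - W ε (G z) 0 x (c.2 x))) + G z 0 ≤
      ∑ x ∈ (grow hd ε c).1, (G z x - W ε (G z) 0 x ((grow hd ε c).2 x)) := by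
  obtain ⟨A, l⟩ := c
  have hne : {n | ((rotorStep ε)^[n] (0, l)).1 ∉ A}.Nonempty := exits ε hε₁ hε₂ hε₃ A _
  have hN := Nat.sInf_mem hne
  have hlt : ∀ i < sInf {n | ((rotorStep ε)^[n] (0, l)).1 ∉ A},
      ((rotorStep ε)^[i] (0, l)).1 ∈ A := by
    intro i hi
    by_contra h
    exact Nat.notMem_of_lt_sInf hi h
  simp only [grow] at hz ⊢
  dsimp only at h0 hJ
  generalize sInf {n | ((rotorStep ε)^[n] (0, l)).1 ∉ A} = N at *
  have hN' : ((rotorStep ε)^[N] (0, l)).1 ∉ A := hN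
  rw [Finset.mem_insert, not_or] at hz
  obtain ⟨w0, w1, w2⟩ := walk ε hε₁ hε₂ hε₃ z A hz.2 (0, l) h0 hJ N hlt (Ne.symm hz.1)
  generalize (rotorStep ε)^[N] (0, l) = w at *
  have hup : Function.update w.2 w.1 (⟨0, by omega⟩ : R4) = w.2 := by
    rw [Function.update_eq_self_iff]; exact (w0 _ hN').symm
  rw [hup]
  refine ⟨fun x hx => w0 x (fun h => hx (Finset.mem_insert_of_mem h)), w1,
    Finset.card_insert_le _ _, ?_⟩
  rw [Finset.sum_insert hN', w0 _ hN', W_zero, Finset.sum_sub_distrib, Finset.sum_sub_distrib]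
  dsimp only at w2
  linarith

theorem grow_sub (hd : 0 < 2) (ε : R4 → D) (c : Finset D × (D → R4)) :
    c.1 ⊆ (grow hd ε c).1 := by
  simp only [grow]
  exact Finset.subset_insert _ _

theorem conf_spec (hd : 0 < 2) (ε : R4 → D)
    (hε₁ : Function.Injective ε) (hε₂ : ∀ k, ε k ∈ Ed 2)
    (hε₃ : ∀ v ∈ Ed 2, ∃ k, ε k = v) (z : D) (m : ℕ) (hz : z ∉ (conf hd ε m).1) :
    (∀ x ∉ (conf hd ε m).1, (conf hd ε m).2 x = ⟨0, by omega⟩) ∧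
    (∀ k, (conf hd ε m).2 (z - ε k) ≤ k) ∧
    (conf hd ε m).1.card ≤ m + 1 ∧ 0 ∈ (conf hd ε m).1 ∧
    (m + 1) * G z 0 ≤
      ∑ x ∈ (conf hd ε m).1, (G z x - W ε (G z) 0 x ((conf hd ε m).2 x)) := by
  induction m with
  | zero =>
    have e : conf hd ε 0 = ({0}, fun _ => ⟨0, by omega⟩) := rfl
    rw [e]
    refine ⟨fun _ _ => rfl, fun k => by simp, by simp, by simp, ?_⟩
    rw [Finset.sum_singleton, W_zero]
    simp
  | succ m ih =>
    have e : conf hd ε (m + 1) = grow hd ε (conf hd ε m) := by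
      simp only [conf, Function.iterate_succ_apply']
    rw [e] at hz ⊢
    obtain ⟨i1, i2, i3, i4, i5⟩ := ih (fun h => hz (grow_sub hd ε _ h))
    obtain ⟨j1, j2, j3, j4⟩ := grow_spec hd ε hε₁ hε₂ hε₃ z _ i1 i2 hz
    refine ⟨j1, j2, by omega, grow_sub hd ε _ i4, ?_⟩
    push_cast
    linarith

theorem W_lower (ε : R4 → D) (z x : D) (j : R4) : -(3 * G z x) ≤ W ε (G z) 0 x j := by
  unfold W
  have e : ∀ f : R4 → ℝ, ∑ k, f k = f 0 + f 1 + f 2 + f 3 := fun f => Fin.sum_univ_four f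
  rw [e]
  have h := G_nonneg z
  have := h x
  have := h (x + ε 0)
  have := h (x + ε 1)
  have := h (x + ε 2)
  fin_cases j <;> simp [Fin.lt_def] <;> linarith

theorem main_bound (hd : 0 < 2) (ε : R4 → D)
    (hε₁ : Function.Injective ε) (hε₂ : ∀ k, ε k ∈ Ed 2)
    (hε₃ : ∀ v ∈ Ed 2, ∃ k, ε k = v) (z : D) (m : ℕ) (hz : z ∉ (conf hd ε m).1) :
    (m + 1) * G z 0 ≤ 4 * ∑ x ∈ (conf hd ε m).1, G z x := by
  obtain ⟨-, -, -, -, h⟩ := conf_spec hd ε hε₁ hε₂ hε₃ z m hz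
  refine h.trans ?_
  rw [Finset.mul_sum]
  apply Finset.sum_le_sum
  intro x _
  linarith [W_lower ε z x ((conf hd ε m).2 x)]

theorem sum_bound : ∃ C : ℝ, 0 < C ∧ ∀ (z : D) (F : Finset D) (L : ℝ), 0 < L →
    ∑ x ∈ F, G z x ≤ L * C + F.card / L ^ 2 := by
  have hs := EisensteinSeries.summable_one_div_norm_rpow (k := 3) (by norm_num)
  have hnn : ∀ x : Fin 2 → ℤ, 0 ≤ ‖x‖ ^ (-(3 : ℝ)) := fun x => by positivity
  refine ⟨(∑' x : Fin 2 → ℤ, ‖x‖ ^ (-(3 : ℝ))) + 1, ?_, ?_⟩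
  · have := tsum_nonneg (L := .unconditional _) hnn
    linarith
  intro z F L hL
  have pt : ∀ x : D, G z x ≤ L * ‖x - z‖ ^ (-(3 : ℝ)) + 1 / L ^ 2 := by
    intro x
    unfold G
    generalize x - z = y
    by_cases hy : y = 0
    · subst hy
      have : sq 0 = 0 := by simp [sq]
      rw [this]
      have := hnn 0
      simp only [div_zero]
      positivity
    have hp : 0 < ‖y‖ := norm_pos_iff.mpr hy
    have hsq : ‖y‖ ^ 2 ≤ sq y := by
      have h0 : ∀ i, (‖y i‖ : ℝ) ^ 2 ≤ sq y := by
        intro i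
        rw [Int.norm_eq_abs, sq_abs]
        unfold sq
        fin_cases i
        · simp; positivity
        · simp; positivity
      have : ‖y‖ ≤ Real.sqrt (sq y) := by
        rw [pi_norm_le_iff_of_nonneg (Real.sqrt_nonneg _)]
        intro i
        exact Real.le_sqrt_of_sq_le (h0 i)
      calc ‖y‖ ^ 2 ≤ (Real.sqrt (sq y)) ^ 2 := by gcongr
        _ = sq y := Real.sq_sqrt (by unfold sq; positivity)
    have h1 : 1 / sq y ≤ 1 / ‖y‖ ^ 2 := one_div_le_one_div_of_le (by positivity) hsq
    refine h1.trans ?_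
    have e3 : ‖y‖ ^ (-(3 : ℝ)) = 1 / ‖y‖ ^ 3 := by
      rw [Real.rpow_neg hp.le, one_div]
      norm_cast
    rw [e3]
    rcases le_total ‖y‖ L with h | h
    · have : 1 / ‖y‖ ^ 2 ≤ L * (1 / ‖y‖ ^ 3) := by
        rw [mul_one_div, div_le_div_iff₀ (by positivity) (by positivity)]
        have : ‖y‖ ^ 3 = ‖y‖ * ‖y‖ ^ 2 := by ring
        rw [one_mul, this]
        gcongr
      have : 0 ≤ 1 / L ^ 2 := by positivity
      linarith
    · have : 1 / ‖y‖ ^ 2 ≤ 1 / L ^ 2 := by gcongr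
      have : 0 ≤ L * (1 / ‖y‖ ^ 3) := by positivity
      linarith
  have hsum : ∑ x ∈ F, ‖x - z‖ ^ (-(3 : ℝ)) ≤ ∑' x : Fin 2 → ℤ, ‖x‖ ^ (-(3 : ℝ)) := by
    rw [← Finset.sum_image (s := F) (g := fun x => x - z)
      (f := fun y : D => ‖y‖ ^ (-(3 : ℝ))) (fun a _ b _ h => by simpa using h)]
    exact hs.sum_le_tsum _ (fun i _ => hnn i)
  calc ∑ x ∈ F, G z x ≤ ∑ x ∈ F, (L * ‖x - z‖ ^ (-(3 : ℝ)) + 1 / L ^ 2) :=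
        Finset.sum_le_sum fun x _ => pt x
    _ = L * ∑ x ∈ F, ‖x - z‖ ^ (-(3 : ℝ)) + F.card / L ^ 2 := by
        rw [Finset.sum_add_distrib, ← Finset.mul_sum, Finset.sum_const, nsmul_eq_mul, mul_one_div]
    _ ≤ _ := by
        have := mul_le_mul_of_nonneg_left hsum hL.le
        linarith

end RR

/-- Weak circularity in two dimensions: for any rotor ordering `ε` and any `ε₀ > 0`, for
all sufficiently large `m`, after `m` particles are deposited at the origin and allowed to
equilibrate, every site `(a, b)` in the open disc of radius `(8m/(3e^{6+ε₀}))^{1/4}`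
centered at the origin — i.e. with `(a² + b²)² < 8m/(3e^{6+ε₀})` — is occupied. -/
theorem rotor_router_disc (ε : Fin (2 * 2) → Zd 2)
    (hε₁ : Function.Injective ε) (hε₂ : ∀ k, ε k ∈ Ed 2)
    (hε₃ : ∀ v ∈ Ed 2, ∃ k, ε k = v) :
    ∀ ε₀ : ℝ, 0 < ε₀ → ∃ M : ℕ, ∀ m : ℕ, M ≤ m → ∀ a b : ℤ,
      ((a : ℝ) ^ 2 + (b : ℝ) ^ 2) ^ 2 < 8 * (m : ℝ) / (3 * Real.exp (6 + ε₀)) →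
      ![a, b] ∈ (conf (by norm_num) ε m).1 := by
  intro ε₀ hε₀
  obtain ⟨C, hC, hb⟩ := RR.sum_bound
  -- with L = √m / (8 C), the bound reads √m < √m / 2 + 4 * 2 * 64 * C ^ 2
  obtain ⟨M, hM⟩ := exists_nat_gt ((1024 * C ^ 2) ^ 2)
  refine ⟨M + 1, fun m hm a b hab => ?_⟩
  by_contra hz
  have h1 := RR.main_bound (by norm_num) ε hε₁ hε₂ hε₃ _ m hz
  obtain ⟨-, -, hcard, h00, -⟩ := RR.conf_spec (by norm_num) ε hε₁ hε₂ hε₃ _ m hz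
  have hm1 : (1 : ℝ) ≤ m := by exact_mod_cast (by omega : 1 ≤ m)
  have hmM : (M : ℝ) ≤ m := by exact_mod_cast (by omega : M ≤ m)
  obtain ⟨r, hr⟩ : ∃ r, r = Real.sqrt m := ⟨_, rfl⟩
  have hr2 : r ^ 2 = m := by rw [hr]; exact Real.sq_sqrt (by linarith)
  have hrp : 0 < r := by rw [hr]; exact Real.sqrt_pos.mpr (by linarith)
  have hrC : 1024 * C ^ 2 < r := by
    rw [hr]; exact Real.lt_sqrt_of_sq_lt (by linarith)
  have hsm : ((a : ℝ) ^ 2 + (b : ℝ) ^ 2) ^ 2 < m := by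
    refine hab.trans_le ?_
    have : 7 ≤ Real.exp (6 + ε₀) := by linarith [Real.add_one_le_exp (6 + ε₀)]
    rw [div_le_iff₀ (by positivity)]
    nlinarith
  have hG : RR.G ![a, b] 0 = 1 / ((a : ℝ) ^ 2 + (b : ℝ) ^ 2) := by
    simp [RR.G, RR.sq]
  have hpos : 0 < (a : ℝ) ^ 2 + (b : ℝ) ^ 2 := by
    rcases (by positivity : 0 ≤ (a : ℝ) ^ 2 + (b : ℝ) ^ 2).lt_or_eq with h | h
    · exact h
    · exfalso
      have ha : (a : ℝ) = 0 := by nlinarith [sq_nonneg (a : ℝ), sq_nonneg (b : ℝ)]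
      have hb : (b : ℝ) = 0 := by nlinarith [sq_nonneg (a : ℝ), sq_nonneg (b : ℝ)]
      have ha' : a = 0 := by exact_mod_cast ha
      have hb' : b = 0 := by exact_mod_cast hb
      apply hz
      rw [ha', hb']
      have : (![0, 0] : Zd 2) = 0 := by ext i; fin_cases i <;> simp
      rw [this]
      exact h00
  have hlr : (a : ℝ) ^ 2 + (b : ℝ) ^ 2 < r := by
    rw [← hr2] at hsm
    exact lt_of_pow_lt_pow_left₀ 2 hrp.le hsm
  have h2 : r ≤ (m + 1) * RR.G ![a, b] 0 := by
    rw [hG, mul_one_div, le_div_iff₀ hpos, ← hr2]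
    nlinarith
  have h3 := hb ![a, b] (conf (by norm_num) ε m).1 (r / (8 * C)) (by positivity)
  have hcard' : (((conf (by norm_num) ε m).1.card : ℕ) : ℝ) ≤ 2 * r ^ 2 := by
    rw [hr2]
    have : (((conf (by norm_num) ε m).1.card : ℕ) : ℝ) ≤ m + 1 := by exact_mod_cast hcard
    linarith
  have h4 : (((conf (by norm_num) ε m).1.card : ℕ) : ℝ) / (r / (8 * C)) ^ 2 ≤ 128 * C ^ 2 := by
    rw [div_le_iff₀ (by positivity)]
    refine hcard'.trans (le_of_eq ?_)
    field_simp
    norm_num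
  have h5 : r / (8 * C) * C = r / 8 := by field_simp
  linarith
end
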